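/- arXiv:2603.00891 — 2 statements merged into one kernel-verified Lean document; each statement's English description precedes it below -/
import Mathlib

section
/- Let (x_n), (a_n), (λ_n), (r_n) be generated by Algorithm 1.1 for a nonempty closed convex set Z ⊆ H and x₀ ∈ L²(Ω,ℱ,P;H). Then (x_n) is a well-defined sequence of square-integrable H-valued random variables, and for every n ∈ ℕ one has Z ⊆ H(x₀(ω), x_n(ω)) ∩ H(x_n(ω), r_n(ω)) for P-a.e. ω. -/
open MeasureTheory Filter RealInnerProductSpace Topology

/-- The half-space `H(x,y) = {z : ⟪z - y, x - y⟫ ≤ 0}`. -/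
def halfSpace {H : Type*} [NormedAddCommGroup H] [InnerProductSpace ℝ H] (x y : H) : Set H :=
  {z : H | ⟪z - y, x - y⟫ ≤ 0}

open scoped Classical in
/-- The outer set `O(x,y,z)`. -/
noncomputable def Oset {H : Type*} [NormedAddCommGroup H] [InnerProductSpace ℝ H]
    (x y z : H) : Set H :=
  if (halfSpace x y ∩ halfSpace y z).Nonempty then halfSpace x y ∩ halfSpace y z else {y}

/-- `q` is the metric projection of `x` onto `C`. -/
def IsProjPt {H : Type*} [NormedAddCommGroup H] [InnerProductSpace ℝ H]
    (C : Set H) (x q : H) : Prop :=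
  q ∈ C ∧ ∀ w ∈ C, ‖x - q‖ ≤ ‖x - w‖

section Haugazeau

variable {H : Type*} [NormedAddCommGroup H] [InnerProductSpace ℝ H]

theorem mem_halfSpace {x y w : H} : w ∈ halfSpace x y ↔ ⟪w - y, x - y⟫ ≤ 0 := Iff.rfl

/-- Relaxing the projection step `x ↦ a` by a factor in `(0, 1]` enlarges the half-space. -/
theorem halfSpace_subset_halfSpace_relaxed (x a : H) {t : ℝ} (ht : t ∈ Set.Ioc (0 : ℝ) 1) :
    halfSpace x a ⊆ halfSpace x (x + t • (a - x)) := by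
  intro w hw
  rw [mem_halfSpace] at hw ⊢
  obtain ⟨h0, h1⟩ := ht
  have hl : w - (x + t • (a - x)) = (w - a) - (1 - t) • (x - a) := by module
  have hr : x - (x + t • (a - x)) = t • (x - a) := by module
  rw [hl, hr, inner_smul_right, inner_sub_left, inner_smul_left, real_inner_self_eq_norm_sq]
  simp only [conj_trivial]
  have := mul_nonneg (sub_nonneg.2 h1) (sq_nonneg ‖x - a‖)
  exact mul_nonpos_of_nonneg_of_nonpos h0.le (by linarith)

/-- A point of `C` satisfying the variational inequality is the only projection onto `C`. -/
theorem IsProjPt.eq_of_subset_halfSpace {C : Set H} {x p q : H} (hp : IsProjPt C x p)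
    (hq : q ∈ C) (hC : C ⊆ halfSpace x q) : p = q := by
  have hle := hp.2 q hq
  have hvar := mem_halfSpace.1 (hC hp.1)
  have hexp : ‖x - p‖ ^ 2 = ‖x - q‖ ^ 2 - 2 * ⟪p - q, x - q⟫ + ‖p - q‖ ^ 2 := by
    rw [real_inner_comm, ← norm_sub_sq_real]
    congr 2
    abel
  have hsq : ‖x - p‖ ^ 2 ≤ ‖x - q‖ ^ 2 := by gcongr
  have hzero : ‖p - q‖ = 0 := by
    have : ‖p - q‖ ^ 2 ≤ 0 := by linarith
    exact pow_eq_zero_iff two_ne_zero |>.1 (le_antisymm this (sq_nonneg _))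
  exact sub_eq_zero.1 (norm_eq_zero.1 hzero)

/-- Karush–Kuhn–Tucker conditions for the projection onto the intersection of two half-spaces. -/
theorem inter_halfSpace_subset_halfSpace {x y z q : H} {α β : ℝ} (hα : 0 ≤ α) (hβ : 0 ≤ β)
    (hq : x - q = α • (x - y) + β • (y - z))
    (hy : α * ⟪q - y, x - y⟫ = 0) (hz : β * ⟪q - z, y - z⟫ = 0) :
    halfSpace x y ∩ halfSpace y z ⊆ halfSpace x q := by
  rintro w ⟨hwy, hwz⟩
  rw [mem_halfSpace] at hwy hwz ⊢
  have h₁ : ⟪w - q, x - y⟫ = ⟪w - y, x - y⟫ - ⟪q - y, x - y⟫ := by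
    rw [← inner_sub_left]; congr 1; abel
  have h₂ : ⟪w - q, y - z⟫ = ⟪w - z, y - z⟫ - ⟪q - z, y - z⟫ := by
    rw [← inner_sub_left]; congr 1; abel
  rw [hq, inner_add_right, inner_smul_right, inner_smul_right, h₁, h₂]
  have := mul_nonpos_of_nonneg_of_nonpos hα hwy
  have := mul_nonpos_of_nonneg_of_nonpos hβ hwz
  linarith

/-- The Gram determinant of `u` and `v`. -/
noncomputable def gramDet (u v : H) : ℝ := ⟪u, u⟫ * ⟪v, v⟫ - ⟪u, v⟫ ^ 2

theorem gramDet_nonneg (u v : H) : 0 ≤ gramDet u v := by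
  have := real_inner_mul_inner_self_le u v
  unfold gramDet
  linarith

theorem eq_smul_of_gramDet_eq_zero {u v : H} (hv : v ≠ 0) (h : gramDet u v = 0) :
    u = (⟪u, v⟫ / ⟪v, v⟫) • v := by
  have hvv : ⟪v, v⟫ ≠ 0 := inner_self_ne_zero.2 hv
  rw [← sub_eq_zero, ← inner_self_eq_zero (𝕜 := ℝ)]
  simp only [inner_sub_left, inner_sub_right, inner_smul_left, inner_smul_right, conj_trivial,
    real_inner_comm u v]
  unfold gramDet at h
  field_simp
  linarith

open scoped Classical in
/-- Haugazeau's formula for the projection of `x` onto `halfSpace x y ∩ halfSpace y z`. -/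
noncomputable def haugazeauPoint (x y z : H) : H :=
  if gramDet (x - y) (y - z) = 0 then z
  else if gramDet (x - y) (y - z) ≤ ⟪x - y, y - z⟫ * ⟪y - z, y - z⟫ then
    x - (1 + ⟪x - y, y - z⟫ / ⟪y - z, y - z⟫) • (y - z)
  else y + (⟪y - z, y - z⟫ / gramDet (x - y) (y - z)) •
    (⟪x - y, y - z⟫ • (x - y) - ⟪x - y, x - y⟫ • (y - z))

theorem haugazeauPoint_mem_and_subset {x y z : H}
    (hne : (halfSpace x y ∩ halfSpace y z).Nonempty) :
    haugazeauPoint x y z ∈ halfSpace x y ∩ halfSpace y z ∧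
      halfSpace x y ∩ halfSpace y z ⊆ halfSpace x (haugazeauPoint x y z) := by
  obtain ⟨u, hu⟩ : ∃ u, u = x - y := ⟨_, rfl⟩
  obtain ⟨v, hv⟩ : ∃ v, v = y - z := ⟨_, rfl⟩
  have hyz : z - y = -v := by rw [hv]; abel
  have hxz : x - z = u + v := by rw [hu, hv]; abel
  have hcomm : ⟪v, u⟫ = ⟪u, v⟫ := real_inner_comm _ _
  have hρ := gramDet_nonneg u v
  unfold haugazeauPoint
  rw [← hu, ← hv]
  split_ifs with hdet hcase
  · by_cases hv0 : v = 0
    · have hzy : z = y := by rw [hv0] at hv; exact (sub_eq_zero.1 hv.symm).symm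
      subst hzy
      simp [Set.subset_def, mem_halfSpace]
    · have huv := eq_smul_of_gramDet_eq_zero hv0 hdet
      have hvv : 0 < ⟪v, v⟫ := real_inner_self_pos.2 hv0
      obtain ⟨c, hc⟩ : ∃ c, c = ⟪u, v⟫ / ⟪v, v⟫ := ⟨_, rfl⟩
      rw [← hc] at huv
      have hc0 : 0 ≤ c := by
        obtain ⟨w, hwy, hwz⟩ := hne
        rw [mem_halfSpace, ← hu, huv, inner_smul_right] at hwy
        rw [mem_halfSpace, ← hv, show w - z = (w - y) + v by rw [hv]; abel,
          inner_add_left] at hwz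
        by_contra! hneg
        have := mul_pos_of_neg_of_neg hneg (show ⟪w - y, v⟫ < 0 by linarith)
        linarith
      refine ⟨⟨?_, by simp [mem_halfSpace]⟩, ?_⟩
      · rw [mem_halfSpace, ← hu, hyz, huv, inner_neg_left, inner_smul_right]
        have := mul_nonneg hc0 hvv.le
        linarith
      · refine inter_halfSpace_subset_halfSpace (α := 0) (β := 1 + c) le_rfl (by linarith)
          ?_ (by simp) (by simp)
        rw [hxz, ← hv]
        nth_rewrite 1 [huv]
        module
  · have hv0 : v ≠ 0 := by rintro rfl; simp [gramDet] at hdet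
    have hvv : 0 < ⟪v, v⟫ := real_inner_self_pos.2 hv0
    have huv : 0 ≤ ⟪u, v⟫ := nonneg_of_mul_nonneg_left (hρ.trans hcase) hvv
    have hy' : x - (1 + ⟪u, v⟫ / ⟪v, v⟫) • v - y = u - (1 + ⟪u, v⟫ / ⟪v, v⟫) • v := by
      rw [hu]; abel
    have hz' : x - (1 + ⟪u, v⟫ / ⟪v, v⟫) • v - z = u - (⟪u, v⟫ / ⟪v, v⟫) • v := by
      rw [sub_right_comm, hxz]; module
    have hzv : ⟪u - (⟪u, v⟫ / ⟪v, v⟫) • v, v⟫ = 0 := by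
      rw [inner_sub_left, inner_smul_left, conj_trivial, div_mul_cancel₀ _ hvv.ne', sub_self]
    refine ⟨⟨?_, ?_⟩, ?_⟩
    · rw [mem_halfSpace, hy', ← hu, inner_sub_left, inner_smul_left, conj_trivial, hcomm]
      have : ⟪u, u⟫ - (1 + ⟪u, v⟫ / ⟪v, v⟫) * ⟪u, v⟫
          = (gramDet u v - ⟪u, v⟫ * ⟪v, v⟫) / ⟪v, v⟫ := by
        unfold gramDet; field_simp; ring
      rw [this]
      exact div_nonpos_of_nonpos_of_nonneg (by linarith) hvv.le
    · rw [mem_halfSpace, hz', ← hv, hzv]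
    · refine inter_halfSpace_subset_halfSpace (α := 0) (β := 1 + ⟪u, v⟫ / ⟪v, v⟫) le_rfl
        (by positivity) ?_ (by simp) ?_
      · rw [← hv]; module
      · rw [hz', ← hv, hzv, mul_zero]
  · have hpos : 0 < gramDet u v := lt_of_le_of_ne hρ (Ne.symm hdet)
    obtain ⟨q, hq⟩ : ∃ q, q = y + (⟪v, v⟫ / gramDet u v) • (⟪u, v⟫ • u - ⟪u, u⟫ • v) := ⟨_, rfl⟩
    rw [← hq]
    have hqy : ⟪q - y, u⟫ = 0 := by
      rw [hq, add_sub_cancel_left, inner_smul_left, inner_sub_left, inner_smul_left,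
        inner_smul_left, hcomm]
      simp only [conj_trivial]
      ring
    have hqz : ⟪q - z, v⟫ = 0 := by
      have : q - z = v + (⟪v, v⟫ / gramDet u v) • (⟪u, v⟫ • u - ⟪u, u⟫ • v) := by
        rw [hq, hv]; abel
      rw [this, inner_add_left, inner_smul_left, inner_sub_left, inner_smul_left,
        inner_smul_left]
      simp only [conj_trivial]
      rw [show ⟪u, v⟫ * ⟪u, v⟫ - ⟪u, u⟫ * ⟪v, v⟫ = -gramDet u v by unfold gramDet; ring]
      field_simp
      ring
    refine ⟨⟨?_, ?_⟩, ?_⟩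
    · rw [mem_halfSpace, ← hu, hqy]
    · rw [mem_halfSpace, ← hv, hqz]
    · refine inter_halfSpace_subset_halfSpace (α := 1 - ⟪u, v⟫ * ⟪v, v⟫ / gramDet u v)
        (β := ⟪v, v⟫ * ⟪u, u⟫ / gramDet u v) ?_ ?_ ?_ ?_ ?_
      · rw [sub_nonneg, div_le_one hpos]
        exact (not_le.1 hcase).le
      · exact div_nonneg (mul_nonneg real_inner_self_nonneg real_inner_self_nonneg) hρ
      · rw [hq, ← hu, ← hv, ← sub_sub, ← hu]
        module
      · rw [← hu, hqy, mul_zero]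
      · rw [← hv, hqz, mul_zero]

theorem measurable_haugazeauPoint [SecondCountableTopology H] [MeasurableSpace H] [BorelSpace H] :
    Measurable fun p : H × H × H => haugazeauPoint p.1 p.2.1 p.2.2 := by
  have hu : Measurable fun p : H × H × H => p.1 - p.2.1 := by fun_prop
  have hv : Measurable fun p : H × H × H => p.2.1 - p.2.2 := by fun_prop
  have huu := hu.inner (𝕜 := ℝ) hu
  have huv := hu.inner (𝕜 := ℝ) hv
  have hvv := hv.inner (𝕜 := ℝ) hv
  have hdet : Measurable fun p : H × H × H => gramDet (p.1 - p.2.1) (p.2.1 - p.2.2) :=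
    (huu.mul hvv).sub (huv.pow_const 2)
  unfold haugazeauPoint
  refine Measurable.ite (measurableSet_eq_fun hdet measurable_const) (by fun_prop) ?_
  refine Measurable.ite (measurableSet_le hdet (huv.mul hvv)) ?_ ?_
  · exact measurable_fst.sub (((huv.div hvv).const_add 1).smul hv)
  · exact (by fun_prop : Measurable fun p : H × H × H => p.2.1).add
      ((hvv.div hdet).smul ((huv.smul hu).sub (huu.smul hv)))

end Haugazeau

/-- Theorem 3.1(i)-(ii): the iterates of the abstract stochastic Haugazeau method are
well-defined square-integrable random variables and `Z ⊆ H(x₀,xₙ) ∩ H(xₙ,rₙ)` a.s. -/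
theorem haugazeau_welldefined {Ω : Type*} [MeasurableSpace Ω] (μ : Measure Ω)
    [IsProbabilityMeasure μ] [μ.IsComplete]
    {H : Type*} [NormedAddCommGroup H] [InnerProductSpace ℝ H] [CompleteSpace H]
    [SecondCountableTopology H] [MeasurableSpace H] [BorelSpace H]
    (Z : Set H) (hZne : Z.Nonempty) (hZcl : IsClosed Z) (hZconv : Convex ℝ Z)
    (x a r : ℕ → Ω → H) (lam : ℕ → Ω → ℝ)
    (hx0 : MemLp (x 0) 2 μ)
    (ha : ∀ n, MemLp (a n) 2 μ)
    (haZ : ∀ n, ∀ᵐ ω ∂μ, Z ⊆ halfSpace (x n ω) (a n ω))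
    (hlam_meas : ∀ n, Measurable (lam n))
    (hlam : ∀ n ω, lam n ω ∈ Set.Ioc (0 : ℝ) 1)
    (hr : ∀ n ω, r n ω = x n ω + lam n ω • (a n ω - x n ω))
    (hxsucc : ∀ n ω, IsProjPt (Oset (x 0 ω) (x n ω) (r n ω)) (x 0 ω) (x (n + 1) ω)) :
    (∀ n, MemLp (x n) 2 μ) ∧
    ∀ n, ∀ᵐ ω ∂μ, Z ⊆ halfSpace (x 0 ω) (x n ω) ∩ halfSpace (x n ω) (r n ω) := by
  have hrelax : ∀ n, (∀ᵐ ω ∂μ, Z ⊆ halfSpace (x n ω) (r n ω)) := by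
    intro n
    filter_upwards [haZ n] with ω hω
    rw [hr]
    exact hω.trans (halfSpace_subset_halfSpace_relaxed _ _ (hlam n ω))
  suffices hind : ∀ n, MemLp (x n) 2 μ ∧ ∀ᵐ ω ∂μ, Z ⊆ halfSpace (x 0 ω) (x n ω) by
    refine ⟨fun n => (hind n).1, fun n => ?_⟩
    filter_upwards [(hind n).2, hrelax n] with ω h₁ h₂ using Set.subset_inter h₁ h₂
  obtain ⟨z, hz⟩ := hZne
  intro n
  induction n with
  | zero => exact ⟨hx0, by simp [Set.subset_def, mem_halfSpace]⟩
  | succ n ih =>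
    obtain ⟨hxn, hZn⟩ := ih
    have hsub : ∀ᵐ ω ∂μ, Z ⊆ halfSpace (x 0 ω) (x n ω) ∩ halfSpace (x n ω) (r n ω) := by
      filter_upwards [hZn, hrelax n] with ω h₁ h₂ using Set.subset_inter h₁ h₂
    have hproj : ∀ᵐ ω ∂μ, IsProjPt (halfSpace (x 0 ω) (x n ω) ∩ halfSpace (x n ω) (r n ω))
        (x 0 ω) (x (n + 1) ω) := by
      filter_upwards [hsub] with ω hω
      simpa only [Oset, if_pos (show Set.Nonempty _ from ⟨z, hω hz⟩)] using hxsucc n ω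
    have heq : ∀ᵐ ω ∂μ, haugazeauPoint (x 0 ω) (x n ω) (r n ω) = x (n + 1) ω := by
      filter_upwards [hproj] with ω hω
      obtain ⟨hmem, hss⟩ := haugazeauPoint_mem_and_subset ⟨_, hω.1⟩
      exact (hω.eq_of_subset_halfSpace hmem hss).symm
    have hrn : AEMeasurable (r n) μ := by
      rw [show r n = fun ω => x n ω + lam n ω • (a n ω - x n ω) from funext (hr n)]
      have hxm := hxn.1.aemeasurable
      exact hxm.add ((hlam_meas n).aemeasurable.smul ((ha n).1.aemeasurable.sub hxm))
    have hmeas : AEStronglyMeasurable (x (n + 1)) μ := by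
      have := measurable_haugazeauPoint.comp_aemeasurable
        (hx0.1.aemeasurable.prodMk (hxn.1.aemeasurable.prodMk hrn))
      exact (this.congr heq).aestronglyMeasurable
    have hdiff : MemLp (fun ω => x 0 ω - x (n + 1) ω) 2 μ := by
      refine (hx0.sub (memLp_const z)).mono (hx0.1.sub hmeas) ?_
      filter_upwards [hproj, hsub] with ω hω hZω using hω.2 z (hZω hz)
    refine ⟨?_, ?_⟩
    · convert hx0.sub hdiff using 1
      ext ω
      simp
    · filter_upwards [hproj, hsub, heq] with ω hω hZω heqω
      rw [← heqω]
      exact hZω.trans (haugazeauPoint_mem_and_subset ⟨_, hω.1⟩).2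
end

section
/- Let (x_n) be generated by Algorithm 1.1 for a nonempty closed convex set Z ⊆ H and x₀ ∈ L²(Ω,ℱ,P;H), with each x_n square-integrable. Then, P-almost surely, the real sequence (‖x_n‖)_{n∈ℕ} is bounded; more precisely, for every n, ‖x_n‖ ≤ ‖proj_Z x₀ − x₀‖ + ‖x₀‖ P-almost surely. -/
open MeasureTheory Filter RealInnerProductSpace Topology

theorem convex_halfSpace {H : Type*} [NormedAddCommGroup H] [InnerProductSpace ℝ H]
    (x y : H) : Convex ℝ (halfSpace x y) := by
  have h : halfSpace x y = {z : H | innerSL ℝ (x - y) z ≤ ⟪x - y, y⟫} := by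
    ext z
    simp only [halfSpace, Set.mem_ofPred_eq, innerSL_apply_apply]
    rw [real_inner_comm, inner_sub_right, sub_nonpos]
  rw [h]
  exact convex_halfSpace_le (innerSL ℝ (x - y)).toLinearMap.isLinear _

/-- A convex set lies in the half-space determined by a point and its projection. -/
theorem IsProjPt.subset_halfSpace {H : Type*} [NormedAddCommGroup H] [InnerProductSpace ℝ H]
    {C : Set H} {x q : H} (hC : Convex ℝ C) (h : IsProjPt C x q) : C ⊆ halfSpace x q := by
  intro w hw
  have : Nonempty C := ⟨⟨q, h.1⟩⟩
  have hinf : ‖x - q‖ = ⨅ v : C, ‖x - v‖ := by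
    refine le_antisymm (le_ciInf fun v => h.2 v v.2) ?_
    exact ciInf_le ⟨0, by rintro _ ⟨v, rfl⟩; exact norm_nonneg _⟩ (⟨q, h.1⟩ : C)
  have hw' := (norm_eq_iInf_iff_real_inner_le_zero hC h.1).1 hinf w hw
  rwa [real_inner_comm] at hw'

/-- Moving `y` back towards `x` enlarges the half-space. -/
theorem halfSpace_subset_relaxed {H : Type*} [NormedAddCommGroup H] [InnerProductSpace ℝ H]
    (x y : H) {t : ℝ} (ht : t ∈ Set.Icc (0 : ℝ) 1) :
    halfSpace x y ⊆ halfSpace x (x + t • (y - x)) := by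
  intro z hz
  simp only [halfSpace, Set.mem_ofPred_eq] at hz ⊢
  have h1 : z - (x + t • (y - x)) = (z - y) - (1 - t) • (x - y) := by module
  have h2 : x - (x + t • (y - x)) = t • (x - y) := by module
  rw [h1, h2, inner_smul_right, inner_sub_left, real_inner_smul_left]
  have h3 : 0 ≤ (1 - t) * ⟪x - y, x - y⟫ :=
    mul_nonneg (sub_nonneg.2 ht.2) real_inner_self_nonneg
  exact mul_nonpos_of_nonneg_of_nonpos ht.1 (by linarith)

theorem norm_sub_le_of_mem_halfSpace {H : Type*} [NormedAddCommGroup H]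
    [InnerProductSpace ℝ H] {x y z : H} (hz : z ∈ halfSpace x y) : ‖x - y‖ ≤ ‖z - x‖ := by
  simp only [halfSpace, Set.mem_ofPred_eq] at hz
  have h : z - x = (z - y) - (x - y) := by abel
  have hsq := norm_sub_sq_real (z - y) (x - y)
  rw [← h] at hsq
  refine le_of_sq_le_sq ?_ (norm_nonneg _)
  nlinarith [sq_nonneg ‖z - y‖]

/-- One Haugazeau step preserves outer approximation of a nonempty set. -/
theorem subset_halfSpace_of_isProjPt_Oset {H : Type*} [NormedAddCommGroup H]
    [InnerProductSpace ℝ H] {Z : Set H} (hZ : Z.Nonempty) {x y z q : H}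
    (hxy : Z ⊆ halfSpace x y) (hyz : Z ⊆ halfSpace y z) (hq : IsProjPt (Oset x y z) x q) :
    Z ⊆ halfSpace x q := by
  have hsub : Z ⊆ halfSpace x y ∩ halfSpace y z := Set.subset_inter hxy hyz
  rw [Oset, if_pos (hZ.mono hsub)] at hq
  exact hsub.trans (hq.subset_halfSpace ((convex_halfSpace x y).inter (convex_halfSpace y z)))

/-- Theorem 3.1(iv): a.s. the sequence `(‖xₙ‖)` is bounded; more precisely
`‖xₙ‖ ≤ ‖proj_Z x₀ - x₀‖ + ‖x₀‖` a.s. for every n. -/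
theorem haugazeau_bounded
    {Ω : Type*} [MeasurableSpace Ω] (μ : Measure Ω)
    [IsProbabilityMeasure μ] [μ.IsComplete]
    {H : Type*} [NormedAddCommGroup H] [InnerProductSpace ℝ H] [CompleteSpace H]
    [SecondCountableTopology H] [MeasurableSpace H] [BorelSpace H]
    (Z : Set H) (hZne : Z.Nonempty) (hZcl : IsClosed Z) (hZconv : Convex ℝ Z)
    (x a r : ℕ → Ω → H) (lam : ℕ → Ω → ℝ)
    (hx0 : MemLp (x 0) 2 μ)
    (hxL2 : ∀ n, MemLp (x n) 2 μ)
    (ha : ∀ n, MemLp (a n) 2 μ)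
    (haZ : ∀ n, ∀ᵐ ω ∂μ, Z ⊆ halfSpace (x n ω) (a n ω))
    (hlam_meas : ∀ n, Measurable (lam n))
    (hlam : ∀ n ω, lam n ω ∈ Set.Ioc (0 : ℝ) 1)
    (hr : ∀ n ω, r n ω = x n ω + lam n ω • (a n ω - x n ω))
    (hxsucc : ∀ n ω, IsProjPt (Oset (x 0 ω) (x n ω) (r n ω)) (x 0 ω) (x (n + 1) ω))
    (pZ : H → H) (hpZ : ∀ v : H, IsProjPt Z v (pZ v)) :
    (∀ᵐ ω ∂μ, ∃ C : ℝ, ∀ n, ‖x n ω‖ ≤ C) ∧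
    ∀ n, ∀ᵐ ω ∂μ, ‖x n ω‖ ≤ ‖pZ (x 0 ω) - x 0 ω‖ + ‖x 0 ω‖ := by
  have key : ∀ᵐ ω ∂μ, ∀ n, ‖x n ω‖ ≤ ‖pZ (x 0 ω) - x 0 ω‖ + ‖x 0 ω‖ := by
    filter_upwards [ae_all_iff.2 haZ] with ω hω
    have hsub : ∀ n, Z ⊆ halfSpace (x 0 ω) (x n ω) := by
      intro n
      induction n with
      | zero => intro z _; simp [halfSpace]
      | succ n ih =>
        refine subset_halfSpace_of_isProjPt_Oset hZne ih ?_ (hxsucc n ω)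
        rw [hr]
        exact (hω n).trans (halfSpace_subset_relaxed _ _ (Set.Ioc_subset_Icc_self (hlam n ω)))
    intro n
    have h := norm_sub_le_of_mem_halfSpace (hsub n (hpZ (x 0 ω)).1)
    have htri := norm_le_norm_add_norm_sub (x 0 ω) (x n ω)
    linarith
  exact ⟨key.mono fun ω h => ⟨_, h⟩, ae_all_iff.1 key⟩
end
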